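/- Let a ∈ ℝ and b > 0 with a² ≤ 4b, let f_{a,b} be the free Meixner density, and let m_k = ∫_ℝ xᵏ·f_{a,b}(x) dx denote its k-th moment. Then m₀ = 1, m₁ = 0, and for every natural number n ≥ 0, (1 + b)·m_{n+2} = Σ_{j=0}^{n} m_j·(m_{n−j} + a·m_{n+1−j} + b·m_{n+2−j}). -/

import Mathlib

open MeasureTheory

/-- The free Meixner density with parameters `a ∈ ℝ`, `b > 0`, `a² ≤ 4b`. -/
noncomputable def freeMeixnerDensity (a b : ℝ) (x : ℝ) : ℝ :=
  if x ∈ Set.Icc (a - 2 * Real.sqrt (1 + b)) (a + 2 * Real.sqrt (1 + b)) then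
    Real.sqrt (4 * (1 + b) - (x - a) ^ 2) / (2 * Real.pi * (b * x ^ 2 + a * x + 1))
  else 0

open Polynomial

/-- The monic orthogonal polynomials of the semicircle law with mean `a` and variance `1 + b`. -/
noncomputable def semicirclePoly (a b : ℝ) : ℕ → ℝ[X]
  | 0 => 1
  | 1 => X - C a
  | k + 2 => (X - C a) * semicirclePoly a b (k + 1) - C (1 + b) * semicirclePoly a b k

/-- The linear map sending a polynomial `p` to the functional with moments `c`, applied in `y` to
the divided difference `(p(x) - p(y)) / (x - y)`. -/
noncomputable def convShift (c : ℕ → ℝ) : ℝ[X] →ₗ[ℝ] ℝ[X] :=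
  Polynomial.lsum fun n => LinearMap.toSpanSingleton ℝ ℝ[X]
    (∑ j ∈ Finset.range n, C (c (n - 1 - j)) * X ^ j)

theorem convShift_X_pow (c : ℕ → ℝ) (n : ℕ) :
    convShift c (X ^ n) = ∑ j ∈ Finset.range n, C (c (n - 1 - j)) * X ^ j := by
  rw [convShift, Polynomial.lsum_apply, X_pow_eq_monomial, sum_monomial_index] <;> simp

theorem convShift_X_mul (W : ℝ[X] →ₗ[ℝ] ℝ) (p : ℝ[X]) :
    convShift (fun n => W (X ^ n)) (X * p) =
      X * convShift (fun n => W (X ^ n)) p + C (W p) := by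
  induction p using Polynomial.induction_on' with
  | add p q hp hq => rw [mul_add, map_add, hp, hq, map_add, map_add, map_add]; ring
  | monomial n r =>
    have h : monomial n r = r • (X ^ n : ℝ[X]) := by
      rw [X_pow_eq_monomial, smul_monomial, smul_eq_mul, mul_one]
    rw [h, mul_smul_comm, map_smul, map_smul, ← pow_succ', convShift_X_pow, convShift_X_pow,
      map_smul, Finset.sum_range_succ', mul_smul_comm, smul_eq_mul, C_mul, ← smul_eq_C_mul (a := r),
      ← smul_add, Finset.mul_sum]
    congr 2
    · refine Finset.sum_congr rfl fun j _ => ?_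
      rw [show n + 1 - 1 - (j + 1) = n - 1 - j by omega]
      ring
    · simp

section Recursion

variable {a b : ℝ} {L : ℝ[X] →ₗ[ℝ] ℝ}

theorem X_mul_semicirclePoly (a b : ℝ) (k : ℕ) :
    X * semicirclePoly a b (k + 1) = semicirclePoly a b (k + 2) + a • semicirclePoly a b (k + 1)
      + (1 + b) • semicirclePoly a b k := by
  rw [show semicirclePoly a b (k + 2) = (X - C a) * semicirclePoly a b (k + 1)
    - C (1 + b) * semicirclePoly a b k from rfl, smul_eq_C_mul, smul_eq_C_mul]
  ring

theorem X_mul_semicirclePoly_zero (a b : ℝ) :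
    X * semicirclePoly a b 0 = semicirclePoly a b 1 + a • semicirclePoly a b 0 := by
  simp [semicirclePoly, smul_eq_C_mul]

theorem span_range_semicirclePoly (a b : ℝ) :
    Submodule.span ℝ (Set.range (semicirclePoly a b)) = ⊤ := by
  set T := Submodule.span ℝ (Set.range (semicirclePoly a b))
  have hV (k : ℕ) : semicirclePoly a b k ∈ T := Submodule.subset_span ⟨k, rfl⟩
  have hX : T ≤ T.comap (LinearMap.mulLeft ℝ X) := by
    refine Submodule.span_le.mpr ?_
    rintro _ ⟨k, rfl⟩
    change X * _ ∈ T
    cases k with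
    | zero =>
      rw [X_mul_semicirclePoly_zero]
      exact T.add_mem (hV _) (T.smul_mem _ (hV _))
    | succ k =>
      rw [X_mul_semicirclePoly]
      exact T.add_mem (T.add_mem (hV _) (T.smul_mem _ (hV _))) (T.smul_mem _ (hV _))
  have hpow (n : ℕ) : (X ^ n : ℝ[X]) ∈ T := by
    induction n with
    | zero => exact hV 0
    | succ n ih => rw [pow_succ']; exact hX ih
  refine eq_top_iff.mpr fun p _ => ?_
  rw [p.as_sum_range_C_mul_X_pow]
  refine T.sum_mem fun i _ => ?_
  rw [← smul_eq_C_mul]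
  exact T.smul_mem _ (hpow i)

theorem map_X_mul_semicirclePoly
    (h : ∀ k, L (semicirclePoly a b (k + 2)) + a * L (semicirclePoly a b (k + 1))
      + b * L (semicirclePoly a b k) = 0) (k : ℕ) :
    L (X * semicirclePoly a b (k + 1)) = L (semicirclePoly a b k) := by
  rw [X_mul_semicirclePoly]
  simp only [map_add, map_smul, smul_eq_mul]
  linarith [h k]

theorem map_mul_semicirclePoly (h0 : L (semicirclePoly a b 0) = 1)
    (h1 : L (semicirclePoly a b 1) = -a)
    (h : ∀ k, L (semicirclePoly a b (k + 2)) + a * L (semicirclePoly a b (k + 1))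
      + b * L (semicirclePoly a b k) = 0) (k : ℕ) :
    L ((1 + C a * X + C b * X ^ 2) * semicirclePoly a b k) = if k = 0 then 1 + b else 0 := by
  have hX := map_X_mul_semicirclePoly h
  have e (p : ℝ[X]) : L ((1 + C a * X + C b * X ^ 2) * p)
      = L p + a * L (X * p) + b * L (X * (X * p)) := by
    rw [show (1 + C a * X + C b * X ^ 2) * p = p + a • (X * p) + b • (X * (X * p)) by
      simp only [smul_eq_C_mul]; ring]
    simp
  have hz : L (X * semicirclePoly a b 0) = 0 := by
    rw [X_mul_semicirclePoly_zero, map_add, map_smul, h0, h1]; simp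
  rw [e]
  match k with
  | 0 =>
    rw [hz, X_mul_semicirclePoly_zero, mul_add, mul_smul_comm, map_add, map_smul, hz, hX, h0]
    simp
  | 1 =>
    rw [hX, X_mul_semicirclePoly, mul_add, mul_add, mul_smul_comm, mul_smul_comm, map_add,
      map_add, map_smul, map_smul, hX, hX, hz, h1, h0]
    simp
  | k + 2 =>
    rw [hX, X_mul_semicirclePoly, mul_add, mul_add, mul_smul_comm, mul_smul_comm, map_add,
      map_add, map_smul, map_smul, hX, hX, hX, if_neg (by omega)]
    simp only [smul_eq_mul]
    linear_combination (1 + b) * h k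

theorem map_convShift (h0 : L (semicirclePoly a b 0) = 1)
    (h1 : L (semicirclePoly a b 1) = -a)
    (h : ∀ k, L (semicirclePoly a b (k + 2)) + a * L (semicirclePoly a b (k + 1))
      + b * L (semicirclePoly a b k) = 0) (p : ℝ[X]) :
    L (convShift (fun n => L ((1 + C a * X + C b * X ^ 2) * X ^ n)) p) = (1 + b) * L (X * p) := by
  set W : ℝ[X] →ₗ[ℝ] ℝ := L ∘ₗ LinearMap.mulLeft ℝ (1 + C a * X + C b * X ^ 2) with hW
  have hWV (k : ℕ) : W (semicirclePoly a b k) = if k = 0 then 1 + b else 0 :=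
    map_mul_semicirclePoly h0 h1 h k
  have hX := convShift_X_mul W
  change L (convShift (fun n => W (X ^ n)) p) = _
  set S := convShift fun n => W (X ^ n)
  have hS0 : S (semicirclePoly a b 0) = 0 := by
    have := convShift_X_pow (fun n => W (X ^ n)) 0
    rwa [Finset.sum_range_zero, pow_zero] at this
  have hS (k : ℕ) : S (semicirclePoly a b (k + 1)) = (1 + b) • semicirclePoly a b k := by
    have h0' := hX (semicirclePoly a b 0)
    rw [X_mul_semicirclePoly_zero, map_add, map_smul, hS0, hWV] at h0'
    have hk (k : ℕ) := hX (semicirclePoly a b (k + 1))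
    simp only [X_mul_semicirclePoly, map_add, map_smul, hWV] at hk
    have h1' : S (semicirclePoly a b 1) = (1 + b) • semicirclePoly a b 0 := by
      simpa [semicirclePoly, smul_eq_C_mul] using h0'
    induction k using Nat.twoStepInduction with
    | zero => exact h1'
    | one =>
      have := hk 0
      rw [h1', hS0, mul_smul_comm, X_mul_semicirclePoly_zero] at this
      simp only [Nat.add_eq_zero_iff, one_ne_zero, and_false, if_false, C_0,
        smul_eq_C_mul] at this ⊢
      linear_combination this
    | more k ih₀ ih₁ =>
      have := hk (k + 1)
      rw [ih₁, ih₀, mul_smul_comm, X_mul_semicirclePoly] at this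
      simp only [Nat.add_eq_zero_iff, one_ne_zero, and_false, if_false, C_0,
        smul_eq_C_mul] at this ⊢
      linear_combination this
  refine LinearMap.congr_fun (f := L ∘ₗ S)
    (g := (1 + b) • L ∘ₗ LinearMap.mulLeft ℝ X) (LinearMap.ext_on_range
      (span_range_semicirclePoly a b) fun k => ?_) p
  simp only [LinearMap.comp_apply, LinearMap.smul_apply, LinearMap.mulLeft_apply, smul_eq_mul]
  match k with
  | 0 => rw [hS0, X_mul_semicirclePoly_zero, map_add, map_smul, h0, h1]; simp
  | k + 1 => rw [hS, map_X_mul_semicirclePoly h, map_smul, smul_eq_mul]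

theorem moment_recursion (h0 : L (semicirclePoly a b 0) = 1)
    (h1 : L (semicirclePoly a b 1) = -a)
    (h : ∀ k, L (semicirclePoly a b (k + 2)) + a * L (semicirclePoly a b (k + 1))
      + b * L (semicirclePoly a b k) = 0) (n : ℕ) :
    (1 + b) * L (X ^ (n + 2)) = ∑ j ∈ Finset.range (n + 1), L (X ^ j) *
      (L (X ^ (n - j)) + a * L (X ^ (n + 1 - j)) + b * L (X ^ (n + 2 - j))) := by
  have key := map_convShift h0 h1 h (X ^ (n + 1))
  rw [← pow_succ', convShift_X_pow, map_sum] at key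
  refine key.symm.trans (Finset.sum_congr rfl fun j hj => ?_)
  have hj : j ≤ n := Nat.lt_succ_iff.mp (Finset.mem_range.mp hj)
  rw [show n + 1 - 1 - j = n - j by omega, show n + 1 - j = n - j + 1 by omega,
    show n + 2 - j = n - j + 2 by omega, ← smul_eq_C_mul, map_smul, smul_eq_mul,
    show ((1 + C a * X + C b * X ^ 2) * X ^ (n - j) : ℝ[X])
      = X ^ (n - j) + a • X ^ (n - j + 1) + b • X ^ (n - j + 2) by
        simp only [smul_eq_C_mul]; ring]
  simp only [map_add, map_smul, smul_eq_mul]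
  ring

end Recursion

section Analysis

variable {a b s : ℝ}

/-- For `a² ≤ 4b` and `s² = 1 + b`, the polynomial `s² + a s z + b z²` has no zero in the closed
unit disc. -/
theorem jostPoly_ne_zero (hb : 0 < b) (hab : a ^ 2 ≤ 4 * b) (hs : s ^ 2 = 1 + b) {z : ℂ}
    (hz : ‖z‖ ≤ 1) : (s ^ 2 + a * s * z + b * z ^ 2 : ℂ) ≠ 0 := by
  intro h
  have hz : z.re ^ 2 + z.im ^ 2 ≤ 1 := by
    rw [← Complex.sq_norm_sub_sq_re]
    nlinarith [norm_nonneg z]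
  have hre := congrArg Complex.re h
  have him := congrArg Complex.im h
  simp [pow_two] at hre him
  have hfac : z.im * (a * s + 2 * b * z.re) = 0 := by linear_combination him
  rcases mul_eq_zero.mp hfac with hi | hi
  · rw [hi] at hre hz
    have hdisc := mul_nonneg (sub_nonneg.mpr hab) (sq_nonneg z.re)
    have hsq : (2 * s + a * z.re) ^ 2 = 0 :=
      le_antisymm (by linarith) (sq_nonneg _)
    have hlin : a * z.re = -(2 * s) := by linarith [pow_eq_zero_iff two_ne_zero |>.mp hsq]
    have hmul : a ^ 2 * z.re ^ 2 = 4 * s ^ 2 := by rw [← mul_pow, hlin]; ring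
    nlinarith
  · have : s ^ 2 = b * (z.re ^ 2 + z.im ^ 2) := by linear_combination hre - z.re * hi
    nlinarith

theorem normSq_jostPoly (hs : s ^ 2 = 1 + b) (θ : ℝ) :
    Complex.normSq (s ^ 2 + a * s * circleMap 0 1 θ + b * circleMap 0 1 θ ^ 2) =
      b * (a + 2 * s * Real.cos θ) ^ 2 + a * (a + 2 * s * Real.cos θ) + 1 := by
  have hz : circleMap 0 1 θ = ⟨Real.cos θ, Real.sin θ⟩ := by
    apply Complex.ext <;> simp [circleMap, Complex.exp_ofReal_mul_I_re, Complex.exp_ofReal_mul_I_im]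
  rw [hz, Complex.normSq_apply]
  simp [pow_two]
  obtain rfl : b = s ^ 2 - 1 := by linarith
  have h : Real.sin θ ^ 2 = 1 - Real.cos θ ^ 2 := Real.sin_sq θ
  generalize Real.cos θ = c at *
  generalize Real.sin θ = t at *
  ring_nf
  simp only [show t ^ 4 = (t ^ 2) ^ 2 by ring, h]
  ring

theorem meixner_denom_pos (hb : 0 < b) (hab : a ^ 2 ≤ 4 * b) (hs : s ^ 2 = 1 + b) (θ : ℝ) :
    0 < b * (a + 2 * s * Real.cos θ) ^ 2 + a * (a + 2 * s * Real.cos θ) + 1 := by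
  rw [← normSq_jostPoly hs]
  exact Complex.normSq_pos.mpr (jostPoly_ne_zero hb hab hs (by simp))

theorem re_mul_div_jostPoly (hb : 0 < b) (hab : a ^ 2 ≤ 4 * b) (hs : s ^ 2 = 1 + b) (n : ℕ)
    (θ : ℝ) :
    (circleMap 0 1 θ ^ n * (circleMap 0 1 θ ^ 2 - 1) /
      (s ^ 2 + a * s * circleMap 0 1 θ + b * circleMap 0 1 θ ^ 2)).re =
    -2 * (Real.sin θ * (s ^ 2 * Real.sin ((n + 1) * θ) + a * s * Real.sin (n * θ)
      + b * Real.sin ((n - 1) * θ)) /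
      (b * (a + 2 * s * Real.cos θ) ^ 2 + a * (a + 2 * s * Real.cos θ) + 1)) := by
  rw [Complex.div_re, normSq_jostPoly hs]
  have hQ := meixner_denom_pos hb hab hs θ
  rw [← add_div, mul_div_assoc', div_left_inj' hQ.ne']
  have hz : circleMap 0 1 θ = ⟨Real.cos θ, Real.sin θ⟩ := by
    apply Complex.ext <;> simp [circleMap, Complex.exp_ofReal_mul_I_re, Complex.exp_ofReal_mul_I_im]
  have hzn : circleMap 0 1 θ ^ n = ⟨Real.cos (n * θ), Real.sin (n * θ)⟩ := by
    rw [circleMap_zero, Complex.ofReal_one, one_mul, ← Complex.exp_nat_mul, ← mul_assoc,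
      ← Complex.ofReal_natCast, ← Complex.ofReal_mul]
    apply Complex.ext <;> simp only [Complex.exp_ofReal_mul_I_re, Complex.exp_ofReal_mul_I_im]
  rw [hzn, hz, add_mul, sub_mul, one_mul, Real.sin_add, Real.sin_sub]
  simp [pow_two]
  have h : Real.sin θ ^ 2 = 1 - Real.cos θ ^ 2 := Real.sin_sq θ
  generalize Real.cos θ = c at *
  generalize Real.sin θ = t at *
  ring_nf
  simp only [show t ^ 4 = (t ^ 2) ^ 2 by ring, show t ^ 3 = (t ^ 2) * t by ring, h]
  ring

theorem integral_recurrence (hb : 0 < b) (hab : a ^ 2 ≤ 4 * b) (hs : s ^ 2 = 1 + b) (n : ℕ) :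
    ∫ θ in (0 : ℝ)..Real.pi, Real.sin θ * (s ^ 2 * Real.sin ((n + 1) * θ)
      + a * s * Real.sin (n * θ) + b * Real.sin ((n - 1) * θ)) /
      (b * (a + 2 * s * Real.cos θ) ^ 2 + a * (a + 2 * s * Real.cos θ) + 1) =
    if n = 0 then Real.pi / (2 * s ^ 2) else 0 := by
  set E : ℝ → ℝ := fun θ => Real.sin θ * (s ^ 2 * Real.sin ((n + 1) * θ)
      + a * s * Real.sin (n * θ) + b * Real.sin ((n - 1) * θ)) /
      (b * (a + 2 * s * Real.cos θ) ^ 2 + a * (a + 2 * s * Real.cos θ) + 1) with hE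
  set g : ℂ → ℂ := fun z => z ^ n * (z ^ 2 - 1) / (s ^ 2 + a * s * z + b * z ^ 2) with hg
  have hEc : Continuous E := by
    have := fun θ => (meixner_denom_pos hb hab hs θ).ne'
    fun_prop (disch := assumption)
  have hgd : DifferentiableOn ℂ g (Metric.closedBall 0 1) := by
    intro z hz
    have := jostPoly_ne_zero hb hab hs (mem_closedBall_zero_iff.mp hz)
    refine DifferentiableAt.differentiableWithinAt ?_
    fun_prop (disch := assumption)
  have hmean : Real.circleAverage g 0 1 = g 0 := by
    refine DiffContOnCl.circleAverage (DifferentiableOn.diffContOnCl ?_)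
    rwa [abs_one, closure_ball 0 one_ne_zero]
  have hgi : CircleIntegrable g 0 1 :=
    (hgd.continuousOn.mono Metric.sphere_subset_closedBall).circleIntegrable zero_le_one
  have hfull : ∫ θ in (0 : ℝ)..2 * Real.pi, E θ = -Real.pi * (g 0).re := by
    have h := Complex.reCLM.intervalIntegral_comp_comm hgi
    simp only [Complex.reCLM_apply] at h
    rw [intervalIntegral.integral_congr (g := fun θ => -2 * E θ)
      fun θ _ => re_mul_div_jostPoly hb hab hs n θ,
      intervalIntegral.integral_const_mul] at h
    rw [← hmean, Real.circleAverage_def, Complex.smul_re, ← h, smul_eq_mul]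
    field_simp
  have hrefl : ∫ θ in Real.pi..2 * Real.pi, E θ = ∫ θ in (0 : ℝ)..Real.pi, E θ := by
    have h := intervalIntegral.integral_comp_sub_left (a := 0) (b := Real.pi) E (2 * Real.pi)
    rw [sub_zero, two_mul, add_sub_cancel_right, ← two_mul] at h
    rw [← h]
    refine intervalIntegral.integral_congr fun θ _ => ?_
    have key (m : ℤ) : Real.sin (m * (2 * Real.pi - θ)) = -Real.sin (m * θ) := by
      rw [show m * (2 * Real.pi - θ) = m * (2 * Real.pi) - m * θ by ring,
        Real.sin_int_mul_two_pi_sub]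
    have h1 := key (n + 1)
    have h2 := key n
    have h3 := key (n - 1)
    push_cast at h1 h2 h3
    simp only [hE, h1, h2, h3, Real.sin_two_pi_sub, Real.cos_two_pi_sub]
    ring
  have hadd := intervalIntegral.integral_add_adjacent_intervals
    (hEc.intervalIntegrable (μ := volume) 0 Real.pi)
    (hEc.intervalIntegrable (μ := volume) Real.pi (2 * Real.pi))
  rw [hfull, hrefl, ← two_mul] at hadd
  have hg0 : (g 0).re = if n = 0 then -1 / s ^ 2 else 0 := by
    rw [hg]
    split_ifs with hn
    · subst hn
      simp [← Complex.ofReal_pow]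
    · simp [hn]
  rw [hg0] at hadd
  rw [show ∫ θ in (0 : ℝ)..Real.pi, E θ
    = -Real.pi * (if n = 0 then -1 / s ^ 2 else 0) / 2 by linarith]
  split_ifs
  · field_simp
  · simp

theorem integral_mul_freeMeixnerDensity (hb : 0 < b) (hab : a ^ 2 ≤ 4 * b)
    (hs : s = Real.sqrt (1 + b)) (q : ℝ → ℝ) (hq : Continuous q) :
    ∫ x, q x * freeMeixnerDensity a b x = ∫ θ in (0 : ℝ)..Real.pi,
      q (a + 2 * s * Real.cos θ) * (2 * s ^ 2 / Real.pi * (Real.sin θ ^ 2 /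
      (b * (a + 2 * s * Real.cos θ) ^ 2 + a * (a + 2 * s * Real.cos θ) + 1))) := by
  have hs0 : 0 < s := hs ▸ Real.sqrt_pos.mpr (by linarith)
  have hs2 : s ^ 2 = 1 + b := hs ▸ Real.sq_sqrt (by linarith)
  set G : ℝ → ℝ := fun x => q x *
    (Real.sqrt (4 * (1 + b) - (x - a) ^ 2) / (2 * Real.pi * (b * x ^ 2 + a * x + 1))) with hG
  have h1 : ∫ x, q x * freeMeixnerDensity a b x = ∫ x in (a - 2 * s)..(a + 2 * s), G x := by
    rw [intervalIntegral.integral_of_le (by linarith), ← integral_Icc_eq_integral_Ioc,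
      ← integral_indicator measurableSet_Icc]
    refine integral_congr_ae (Filter.Eventually.of_forall fun x => ?_)
    simp only [freeMeixnerDensity, Set.indicator_apply, ← hs, hG, mul_ite, mul_zero]
  have h2 := intervalIntegral.integral_comp_mul_deriv'' (a := 0) (b := Real.pi) (g := G)
    (f := fun θ => a + 2 * s * Real.cos θ) (f' := fun θ => 2 * s * -Real.sin θ)
    (by fun_prop)
    (fun θ _ => (((Real.hasDerivAt_cos θ).const_mul (2 * s)).const_add a).hasDerivWithinAt)
    (by fun_prop) (by
      rintro _ ⟨θ, _, rfl⟩
      have := (meixner_denom_pos hb hab hs2 θ).ne'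
      have hpi := Real.pi_ne_zero
      refine ContinuousAt.continuousWithinAt ?_
      refine hq.continuousAt.mul (ContinuousAt.div (by fun_prop) (by fun_prop) ?_)
      positivity)
  rw [Real.cos_zero, Real.cos_pi, mul_one, mul_neg_one, ← sub_eq_add_neg,
    intervalIntegral.integral_symm (a - 2 * s) (a + 2 * s)] at h2
  rw [h1, ← neg_eq_iff_eq_neg.mpr h2, ← intervalIntegral.integral_neg]
  refine intervalIntegral.integral_congr fun θ hθ => ?_
  rw [Set.uIcc_of_le Real.pi_pos.le] at hθ
  have hQ := meixner_denom_pos hb hab hs2 θ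
  have hsin := Real.sin_nonneg_of_mem_Icc hθ
  have hroot : Real.sqrt (4 * (1 + b) - (a + 2 * s * Real.cos θ - a) ^ 2)
      = 2 * s * Real.sin θ := by
    rw [← Real.sqrt_sq (by positivity : 0 ≤ 2 * s * Real.sin θ), ← hs2]
    congr 1
    linear_combination -4 * s ^ 2 * Real.sin_sq_add_cos_sq θ
  simp only [Function.comp_apply, hG, hroot]
  field_simp

theorem sin_mul_eval_semicirclePoly (hs : s ^ 2 = 1 + b) (k : ℕ) (θ : ℝ) :
    Real.sin θ * (semicirclePoly a b k).eval (a + 2 * s * Real.cos θ)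
      = s ^ k * Real.sin ((k + 1) * θ) := by
  induction k using Nat.twoStepInduction with
  | zero => simp [semicirclePoly]
  | one =>
    norm_num [semicirclePoly, Real.sin_two_mul]
    ring
  | more k ih₀ ih₁ =>
    have h3 : Real.sin ((k + 1 + 1 + 1) * θ)
        = 2 * Real.cos θ * Real.sin ((k + 1 + 1) * θ) - Real.sin ((k + 1) * θ) := by
      rw [show (k + 1 + 1 + 1) * θ = (k + 1 + 1) * θ + θ by ring,
        show (k + 1) * θ = (k + 1 + 1) * θ - θ by ring, Real.sin_add, Real.sin_sub]
      ring
    push_cast at ih₁ ⊢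
    rw [show (k : ℝ) + 2 + 1 = k + 1 + 1 + 1 by ring, h3]
    simp only [semicirclePoly, eval_sub, eval_mul, eval_X, eval_C]
    linear_combination 2 * s * Real.cos θ * ih₁ - (1 + b) * ih₀
      + s ^ k * Real.sin ((k + 1) * θ) * hs

/-- Integration against `w θ dθ` on `[0, π]` along the parametrization `x = a + 2 s cos θ`. -/
noncomputable def arcFunctional (a s : ℝ) (w : ℝ → ℝ) (hw : Continuous w) : ℝ[X] →ₗ[ℝ] ℝ where
  toFun p := ∫ θ in (0 : ℝ)..Real.pi, p.eval (a + 2 * s * Real.cos θ) * w θ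
  map_add' p q := by
    simp only [eval_add, add_mul]
    exact intervalIntegral.integral_add
      (Continuous.intervalIntegrable (by fun_prop) _ _)
      (Continuous.intervalIntegrable (by fun_prop) _ _)
  map_smul' r p := by
    simp only [eval_smul, smul_eq_mul, mul_assoc, intervalIntegral.integral_const_mul,
      RingHom.id_apply]

theorem exists_momentFunctional (hb : 0 < b) (hab : a ^ 2 ≤ 4 * b) :
    ∃ L : ℝ[X] →ₗ[ℝ] ℝ, (∀ k : ℕ, L (X ^ k) = ∫ x : ℝ, x ^ k * freeMeixnerDensity a b x) ∧
      L (semicirclePoly a b 0) = 1 ∧ L (semicirclePoly a b 1) = -a ∧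
      ∀ k, L (semicirclePoly a b (k + 2)) + a * L (semicirclePoly a b (k + 1))
        + b * L (semicirclePoly a b k) = 0 := by
  obtain ⟨s, hs⟩ : ∃ s, s = Real.sqrt (1 + b) := ⟨_, rfl⟩
  have hs0 : 0 < s := hs ▸ Real.sqrt_pos.mpr (by linarith)
  have hs2 : s ^ 2 = 1 + b := hs ▸ Real.sq_sqrt (by linarith)
  have hQ := fun θ => (meixner_denom_pos hb hab hs2 θ).ne'
  set Q : ℝ → ℝ := fun θ =>
    b * (a + 2 * s * Real.cos θ) ^ 2 + a * (a + 2 * s * Real.cos θ) + 1 with hQdef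
  have hw : Continuous fun θ => 2 * s ^ 2 / Real.pi * (Real.sin θ ^ 2 / Q θ) := by
    fun_prop (disch := assumption)
  have hI (k : ℕ) : arcFunctional a s _ hw (semicirclePoly a b k) = 2 * s ^ 2 / Real.pi *
      s ^ k * ∫ θ in (0 : ℝ)..Real.pi, Real.sin θ * Real.sin ((k + 1) * θ) / Q θ := by
    rw [← intervalIntegral.integral_const_mul]
    refine intervalIntegral.integral_congr fun θ _ => ?_
    linear_combination
      2 * s ^ 2 / Real.pi * Real.sin θ / Q θ * sin_mul_eval_semicirclePoly (a := a) hs2 k θ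
  have hrec (n : ℕ) := integral_recurrence hb hab hs2 n
  have hsplit (n : ℕ) :
      s ^ 2 * (∫ θ in (0 : ℝ)..Real.pi, Real.sin θ * Real.sin ((n + 1) * θ) / Q θ)
      + a * s * (∫ θ in (0 : ℝ)..Real.pi, Real.sin θ * Real.sin (n * θ) / Q θ)
      + b * (∫ θ in (0 : ℝ)..Real.pi, Real.sin θ * Real.sin ((n - 1) * θ) / Q θ)
      = if n = 0 then Real.pi / (2 * s ^ 2) else 0 := by
    have hi (c : ℝ) : IntervalIntegrable (fun θ => Real.sin θ * Real.sin (c * θ) / Q θ)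
        volume 0 Real.pi := Continuous.intervalIntegrable (by fun_prop (disch := assumption)) _ _
    rw [← hrec n, ← intervalIntegral.integral_const_mul, ← intervalIntegral.integral_const_mul,
      ← intervalIntegral.integral_const_mul,
      ← intervalIntegral.integral_add ((hi _).const_mul _) ((hi _).const_mul _),
      ← intervalIntegral.integral_add (((hi _).const_mul _).add ((hi _).const_mul _))
        ((hi _).const_mul _)]
    refine intervalIntegral.integral_congr fun θ _ => ?_
    simp only [hQdef]
    ring
  have h0 : 2 * s ^ 2 / Real.pi *
      ∫ θ in (0 : ℝ)..Real.pi, Real.sin θ * Real.sin θ / Q θ = 1 := by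
    have h := hsplit 0
    simp only [CharP.cast_eq_zero, zero_add, one_mul, zero_mul, Real.sin_zero, mul_zero, zero_div,
      intervalIntegral.integral_zero, zero_sub, neg_mul, Real.sin_neg, mul_neg, neg_div,
      intervalIntegral.integral_neg, if_true, add_zero] at h
    have hpi := Real.pi_ne_zero
    rw [show ∫ θ in (0 : ℝ)..Real.pi, Real.sin θ * Real.sin θ / Q θ = Real.pi / (2 * s ^ 2) by
      linear_combination h - (∫ θ in (0 : ℝ)..Real.pi, Real.sin θ * Real.sin θ / Q θ) * hs2]
    field_simp
  refine ⟨arcFunctional a s _ hw, fun k => ?_, ?_, ?_, fun k => ?_⟩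
  · rw [integral_mul_freeMeixnerDensity hb hab hs (fun x => x ^ k) (by fun_prop)]
    simp [arcFunctional, hQdef]
  · rw [hI]
    simpa using h0
  · have h := hsplit 1
    rw [hI]
    norm_num at h ⊢
    have h' : s * (s * (∫ θ in (0 : ℝ)..Real.pi, Real.sin θ * Real.sin (2 * θ) / Q θ)
      + a * ∫ θ in (0 : ℝ)..Real.pi, Real.sin θ * Real.sin θ / Q θ) = 0 := by
      linear_combination h
    have h' := (mul_eq_zero.mp h').resolve_left hs0.ne'
    linear_combination 2 * s ^ 2 / Real.pi * h' - a * h0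
  · have h := hsplit (k + 2)
    rw [hI, hI, hI]
    rw [if_neg (by omega)] at h
    push_cast at h ⊢
    rw [show (k : ℝ) + 2 - 1 = k + 1 by ring] at h
    rw [show (k : ℝ) + 1 + 1 = k + 2 by ring]
    linear_combination 2 * s ^ 2 / Real.pi * s ^ k * h

end Analysis

/-- **Moment recursion for the free Meixner law.** Writing
`m k = ∫ x^k f_{a,b}(x) dx` for the moments of the free Meixner law, we have
`m 0 = 1`, `m 1 = 0`, and
`(1+b) m (n+2) = ∑_{j=0}^{n} m j (m (n-j) + a m (n+1-j) + b m (n+2-j))`. -/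
theorem stmt_13 (a b : ℝ) (hb : 0 < b) (hab : a ^ 2 ≤ 4 * b)
    (m : ℕ → ℝ) (hm : ∀ k : ℕ, m k = ∫ x : ℝ, x ^ k * freeMeixnerDensity a b x) :
    m 0 = 1 ∧ m 1 = 0 ∧
      ∀ n : ℕ, (1 + b) * m (n + 2) =
        ∑ j ∈ Finset.range (n + 1),
          m j * (m (n - j) + a * m (n + 1 - j) + b * m (n + 2 - j)) := by
  obtain ⟨L, hL, h0, h1, h⟩ := exists_momentFunctional hb hab
  obtain rfl : m = fun k => L (Polynomial.X ^ k) := funext fun k => (hm k).trans (hL k).symm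
  refine ⟨by simpa [semicirclePoly] using h0, ?_, moment_recursion h0 h1 h⟩
  have hX := X_mul_semicirclePoly_zero a b
  rw [semicirclePoly, mul_one] at hX
  rw [← semicirclePoly.eq_1 a b] at hX
  simp [hX, h0, h1]
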